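/- Let k be an algebraically closed field of characteristic p > 0, let n ≥ 2, and let h_1, …, h_n be integers with 1 < h_i < p for every i. If there exist pairwise distinct elements P_1, …, P_n of k such that the rational function 1/∏_{i=1}^n (x − P_i)^{h_i} is exact, then ∑_{i=1}^n h_i ≥ p + n. -/

import Mathlib

open Polynomial

/-- `HasDerivRF f g` means `g` is the formal derivative of the rational function `f` in `k(x)`:
if `f = u / v` with `v ≠ 0`, then `g = (u' v - u v') / v ^ 2`. -/
def HasDerivRF {k : Type*} [Field k] (f g : RatFunc k) : Prop :=
  ∃ u v : Polynomial k, v ≠ 0 ∧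
    f = algebraMap (Polynomial k) (RatFunc k) u / algebraMap (Polynomial k) (RatFunc k) v ∧
    g = algebraMap (Polynomial k) (RatFunc k)
          (Polynomial.derivative u * v - u * Polynomial.derivative v) /
        algebraMap (Polynomial k) (RatFunc k) (v ^ 2)

/-- A rational function is exact if it is the formal derivative of some rational function. -/
def IsExactRF {k : Type*} [Field k] (g : RatFunc k) : Prop := ∃ f : RatFunc k, HasDerivRF f g

/-- Multiplication by a `p`-th power commutes with iterated derivatives in characteristic `p`. -/
lemma iterate_derivative_pow_char_mul {k : Type*} [Field k] (p : ℕ) [CharP k p]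
    (v q : k[X]) (m : ℕ) :
    derivative^[m] (v ^ p * q) = v ^ p * derivative^[m] q := by
  induction m generalizing q with
  | zero => rfl
  | succ m ih =>
    rw [Function.iterate_succ_apply, Function.iterate_succ_apply, ← ih]
    simp [derivative_pow]

/-- In characteristic `p` the `p`-th iterated derivative vanishes. -/
lemma iterate_derivative_char {k : Type*} [Field k] (p : ℕ) [CharP k p] (hp : 0 < p)
    (q : k[X]) : derivative^[p] q = 0 := by
  ext m
  have hd : p ∣ (m + p).descFactorial p :=
    (Nat.dvd_factorial hp le_rfl).trans (Nat.factorial_dvd_descFactorial _ _)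
  simp [coeff_iterate_derivative, (CharP.cast_eq_zero_iff k p _).2 hd]

/-- A polynomial killed by the `(p - 1)`-st iterated derivative has an antiderivative whose degree
is at most one larger. -/
lemma exists_derivative_eq {k : Type*} [Field k] (p : ℕ) [CharP k p] (hp : p.Prime)
    (q : k[X]) (hq : derivative^[p - 1] q = 0) :
    ∃ H : k[X], derivative H = q ∧ H.natDegree ≤ q.natDegree + 1 := by
  refine ⟨∑ i ∈ Finset.range (q.natDegree + 1), monomial (i + 1) (q.coeff i / (i + 1 : k)), ?_, ?_⟩
  · conv_rhs => rw [q.as_sum_range]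
    rw [derivative_sum]
    refine Finset.sum_congr rfl fun i _ => ?_
    rw [derivative_monomial]
    simp only [Nat.add_sub_cancel, Nat.cast_add, Nat.cast_one]
    congr 1
    by_cases hi : (i + 1 : k) = 0
    · have hdvd : p ∣ i + 1 := by
        rw [← CharP.cast_eq_zero_iff k p]
        exact_mod_cast hi
      have hle := Nat.le_of_dvd (Nat.succ_pos i) hdvd
      obtain ⟨m, rfl⟩ : ∃ m, i = m + (p - 1) := ⟨i - (p - 1), by omega⟩
      have hm : p ∣ m := by
        have h1 : m + (p - 1) + 1 = m + p := by have := hp.pos; omega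
        rw [h1] at hdvd
        exact (Nat.dvd_add_left dvd_rfl).1 hdvd
      have hc := congrArg (fun f => coeff f m) hq
      simp only [coeff_iterate_derivative, coeff_zero, nsmul_eq_mul, mul_eq_zero,
        CharP.cast_eq_zero_iff k p] at hc
      rcases hc with hc | hc
      · exfalso
        rw [Nat.descFactorial_eq_prod_range, hp.prime.dvd_finsetProd_iff] at hc
        obtain ⟨j, hj, hd⟩ := hc
        rw [Finset.mem_range] at hj
        rw [Nat.add_sub_assoc hj.le, Nat.dvd_add_right hm] at hd
        have := Nat.le_of_dvd (by omega) hd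
        omega
      · simp [hc]
    · exact div_mul_cancel₀ _ hi
  · refine natDegree_sum_le_of_forall_le _ _ fun i hi => (natDegree_monomial_le _).trans ?_
    rw [Finset.mem_range] at hi
    omega

/-- A root of `M` at which `M'` vanishes to order `e < p` is a root of order at least `e + 1`. -/
lemma pow_succ_dvd_of_pow_dvd_derivative {k : Type*} [Field k] (p : ℕ) [CharP k p]
    (M : k[X]) (a : k) (ha : M.eval a = 0) (e : ℕ) (he : e < p)
    (hM : (X - C a) ^ e ∣ derivative M) : (X - C a) ^ (e + 1) ∣ M := by
  induction e with
  | zero => simpa [dvd_iff_isRoot] using ha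
  | succ e ih =>
    obtain ⟨q, rfl⟩ := ih (by omega) ((pow_dvd_pow _ e.le_succ).trans hM)
    have hne : ((e + 1 : ℕ) : k) ≠ 0 := by
      rw [Ne, CharP.cast_eq_zero_iff k p]
      exact Nat.not_dvd_of_pos_of_lt e.succ_pos he
    have hd : derivative ((X - C a) ^ (e + 1) * q) =
        (X - C a) ^ e * (C ((e + 1 : ℕ) : k) * q + (X - C a) * derivative q) := by
      rw [derivative_mul, derivative_X_sub_C_pow]
      simp only [Nat.add_sub_cancel, C_eq_natCast]
      ring
    rw [hd, pow_succ, mul_dvd_mul_iff_left (pow_ne_zero _ (X_sub_C_ne_zero a)),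
      dvd_add_left (dvd_mul_right _ _)] at hM
    rw [pow_succ]
    refine mul_dvd_mul_left _ ?_
    rw [dvd_iff_isRoot, IsRoot.def] at hM ⊢
    rw [eval_mul, eval_C] at hM
    exact (mul_eq_zero.1 hM).resolve_left hne

/-- Every choice of values at `n` distinct points is attained by the `p`-th power of a polynomial
of degree less than `n`. -/
lemma exists_pow_eval_eq {k : Type*} [Field k] [IsAlgClosed k] (p : ℕ) (hp : 0 < p)
    {n : ℕ} (hn : 0 < n) (P : Fin n → k) (hP : Function.Injective P) (y : Fin n → k) :
    ∃ K : k[X], K.natDegree ≤ n - 1 ∧ ∀ i, (K ^ p).eval (P i) = y i := by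
  choose z hz using fun i => IsAlgClosed.exists_pow_nat_eq (y i) hp
  refine ⟨Lagrange.interpolate Finset.univ P z, ?_, fun i => ?_⟩
  · have := Lagrange.degree_interpolate_lt (s := Finset.univ) z hP.injOn
    rw [Finset.card_univ, Fintype.card_fin, degree_lt_iff_coeff_zero] at this
    exact natDegree_le_iff_coeff_eq_zero.2 fun m hm => this m (by omega)
  · rw [eval_pow, Lagrange.eval_interpolate_at_node z hP.injOn (Finset.mem_univ i), hz]

/-- If `1 / ∏ (x - Pᵢ) ^ hᵢ` is exact, then the polynomial `∏ (x - Pᵢ) ^ (p - hᵢ)` is killed by the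
`(p - 1)`-st iterated derivative. -/
lemma iterate_derivative_prod_eq_zero {k : Type*} [Field k] (p : ℕ) [CharP k p] (hp : 2 ≤ p)
    {n : ℕ} (h : Fin n → ℕ) (hh : ∀ i, h i ≤ p) (P : Fin n → k)
    (hex : IsExactRF ((∏ i, (RatFunc.X - RatFunc.C (P i)) ^ h i)⁻¹)) :
    derivative^[p - 1] (∏ i, (X - C (P i)) ^ (p - h i)) = 0 := by
  obtain ⟨_, u, v, hv, -, hg⟩ := hex
  set A : k[X] := ∏ i, (X - C (P i)) ^ h i with hA
  set U : k[X] := ∏ i, (X - C (P i)) ^ (p - h i) with hU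
  have hA0 : A ≠ 0 := Finset.prod_ne_zero_iff.2 fun i _ => pow_ne_zero _ (X_sub_C_ne_zero _)
  have hmap : (∏ i, (RatFunc.X - RatFunc.C (P i)) ^ h i) = algebraMap k[X] (RatFunc k) A := by
    simp [hA, map_prod]
  have key : v ^ 2 = A * (derivative u * v - u * derivative v) := by
    apply RatFunc.algebraMap_injective k
    rw [hmap] at hg
    have h1 := RatFunc.algebraMap_ne_zero hA0
    have h2 := RatFunc.algebraMap_ne_zero (pow_ne_zero 2 hv)
    rw [inv_eq_one_div, div_eq_div_iff h1 h2, one_mul] at hg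
    rw [hg, map_mul, mul_comm]
  have hAU : A * U = (∏ i, (X - C (P i))) ^ p := by
    rw [hA, hU, ← Finset.prod_mul_distrib, ← Finset.prod_pow]
    refine Finset.prod_congr rfl fun i _ => ?_
    rw [← pow_add, Nat.add_sub_cancel' (hh i)]
  obtain ⟨m, rfl⟩ : ∃ m, p = m + 2 := ⟨p - 2, by omega⟩
  have hc : ((m + 1 : ℕ) : k[X]) = -1 := by
    have : ((m + 2 : ℕ) : k[X]) = 0 := CharP.cast_eq_zero _ _
    push_cast at this ⊢
    linear_combination this
  have hW : derivative ((∏ i, (X - C (P i))) ^ (m + 2) * (u * v ^ (m + 1))) = v ^ (m + 2) * U := by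
    have h1 := iterate_derivative_pow_char_mul (m + 2) (∏ i, (X - C (P i))) (u * v ^ (m + 1)) 1
    rw [Function.iterate_one] at h1
    rw [h1, ← hAU, derivative_mul, derivative_pow, C_eq_natCast, Nat.add_sub_cancel, hc]
    linear_combination (-U * v ^ m) * key
  have h2 := iterate_derivative_pow_char_mul (m + 2) v U (m + 1)
  rw [← hW, ← Function.iterate_succ_apply, iterate_derivative_char (m + 2) (by omega)] at h2
  exact (mul_eq_zero.1 h2.symm).resolve_left (pow_ne_zero _ hv)

/-- If `k` is algebraically closed of characteristic `p > 0`, `n ≥ 2`, `1 < hᵢ < p`, and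
`1 / ∏ (x - Pᵢ) ^ hᵢ` is exact for some pairwise distinct `Pᵢ`, then `∑ hᵢ ≥ p + n`. -/
theorem stmt0 {k : Type*} [Field k] [IsAlgClosed k] (p : ℕ) [CharP k p] (hp : 0 < p)
    (n : ℕ) (hn : 2 ≤ n) (h : Fin n → ℕ) (hh : ∀ i, 1 < h i ∧ h i < p)
    (hex : ∃ P : Fin n → k, Function.Injective P ∧
      IsExactRF ((∏ i, (RatFunc.X - RatFunc.C (P i)) ^ h i)⁻¹)) :
    p + n ≤ ∑ i, h i := by
  obtain ⟨P, hP, hex⟩ := hex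
  have h0 := hh ⟨0, by omega⟩
  have hprime : p.Prime := (CharP.char_is_prime_or_zero k p).resolve_right hp.ne'
  obtain ⟨H, hH, hHdeg⟩ := exists_derivative_eq p hprime _
    (iterate_derivative_prod_eq_zero p (by omega) h (fun i => (hh i).2.le) P hex)
  obtain ⟨K, hKdeg, hK⟩ := exists_pow_eval_eq p hp (by omega : 0 < n) P hP fun i => H.eval (P i)
  have hM : derivative (H - K ^ p) = ∏ i, (X - C (P i)) ^ (p - h i) := by
    rw [derivative_sub, hH, derivative_pow]
    simp
  have hM0 : H - K ^ p ≠ 0 := by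
    intro h1
    rw [h1, derivative_zero] at hM
    exact Finset.prod_ne_zero_iff.2 (fun i _ => pow_ne_zero _ (X_sub_C_ne_zero _)) hM.symm
  have hdvd : (∏ i, (X - C (P i)) ^ (p - h i + 1)) ∣ H - K ^ p := by
    refine Finset.prod_dvd_of_coprime (fun i _ j _ hij => ?_) fun i _ => ?_
    · exact (pairwise_coprime_X_sub_C hP hij).pow
    · refine pow_succ_dvd_of_pow_dvd_derivative p _ _ (by simp [← hK i]) _
        (by have := hh i; omega) ?_
      rw [hM]
      exact Finset.dvd_prod_of_mem _ (Finset.mem_univ i)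
  have hdeg (e : Fin n → ℕ) : (∏ i, (X - C (P i)) ^ e i).natDegree = ∑ i, e i := by
    rw [natDegree_prod _ _ fun i _ => pow_ne_zero _ (X_sub_C_ne_zero _)]
    simp
  have hle := natDegree_le_of_dvd hdvd hM0
  have hub := natDegree_sub_le H (K ^ p)
  have hKp : (K ^ p).natDegree ≤ p * (n - 1) :=
    natDegree_pow_le.trans (Nat.mul_le_mul_left p hKdeg)
  rw [hdeg, Finset.sum_add_distrib] at hle
  rw [hdeg] at hHdeg
  have hsum : ∑ i, (p - h i) + ∑ i, h i = p * (n - 1) + p := by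
    rw [← Finset.sum_add_distrib, Finset.sum_congr rfl fun i _ => Nat.sub_add_cancel (hh i).2.le]
    obtain ⟨m, rfl⟩ : ∃ m, n = m + 1 := ⟨n - 1, by omega⟩
    simp
    ring
  simp only [Finset.sum_const, Finset.card_univ, Fintype.card_fin, smul_eq_mul, mul_one] at hle
  rcases le_max_iff.1 (hle.trans hub) with h1 | h1 <;> omega
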